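/- (Noiseless geometric decay of the missed support energy for one STP iteration.) Let Φ ∈ ℝ^{m×N} satisfy the RIP of order 3s with constant δ < 1, let μ ≥ 0, let x ∈ ℝ^N be s-sparse, and set y = Φx. Let S′ ⊆ {1,…,N} with |S′| ≤ s and let x′ be a least-squares solution over support S′ for data y. Suppose: ΔS is a set of indices of the s largest magnitude entries of Φ*(y − Φx′); S̃ = S′ ∪ ΔS; x̃ is a least-squares solution over support S̃ for data y; U ⊆ S̃ is a set of indices of the s largest magnitude entries of x̃; u = x̃_U; and S″ is a set of indices of the s largest magnitude entries of u + μΦ*(y − Φu). Set ρ = 2δ(|μ−1| + μδ)√(1+2δ²)/(1−δ²). Then ‖x_{complement of S″}‖₂ ≤ ρ·‖x_{complement of S′}‖₂. -/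

import Mathlib

open Matrix Finset

/-- The Euclidean norm of a vector in `ℝⁿ`. -/
noncomputable def norm2 {n : ℕ} (v : Fin n → ℝ) : ℝ := Real.sqrt (∑ i, (v i) ^ 2)

/-- The support of a vector: the set of indices of its nonzero entries. -/
noncomputable def supp {n : ℕ} (v : Fin n → ℝ) : Finset (Fin n) :=
  Finset.univ.filter (fun i => v i ≠ 0)

/-- `restrict v T` keeps the entries of `v` with indices in `T` and sets all others to zero. -/
def restrict {n : ℕ} (v : Fin n → ℝ) (T : Finset (Fin n)) : Fin n → ℝ :=
  fun i => if i ∈ T then v i else 0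

/-- `Φ` satisfies the restricted isometry property of order `t` with constant `δ`. -/
def RIP (m N : ℕ) (Φ : Matrix (Fin m) (Fin N) ℝ) (t : ℕ) (δ : ℝ) : Prop :=
  ∀ v : Fin N → ℝ, (supp v).card ≤ t →
    (1 - δ) * (norm2 v) ^ 2 ≤ (norm2 (Φ.mulVec v)) ^ 2 ∧
    (norm2 (Φ.mulVec v)) ^ 2 ≤ (1 + δ) * (norm2 v) ^ 2

/-- `z` is a least-squares solution over support `T` for data `y`. -/
def IsLeastSquares {m N : ℕ} (Φ : Matrix (Fin m) (Fin N) ℝ) (y : Fin m → ℝ)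
    (T : Finset (Fin N)) (z : Fin N → ℝ) : Prop :=
  supp z ⊆ T ∧ ∀ w : Fin N → ℝ, supp w ⊆ T →
    norm2 (y - Φ.mulVec z) ≤ norm2 (y - Φ.mulVec w)

/-- `U` is a set of indices of the `k` largest magnitude entries of `v`. -/
def IsLargest {n : ℕ} (v : Fin n → ℝ) (k : ℕ) (U : Finset (Fin n)) : Prop :=
  U.card = k ∧ ∀ i ∈ U, ∀ j ∉ U, |v j| ≤ |v i|

lemma aux_norm2_sq {n : ℕ} (v : Fin n → ℝ) : (norm2 v) ^ 2 = v ⬝ᵥ v := by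
  unfold norm2
  rw [Real.sq_sqrt (Finset.sum_nonneg fun i _ => sq_nonneg _)]
  simp [dotProduct, sq]

lemma aux_restrict_sq {n : ℕ} (v : Fin n → ℝ) (T : Finset (Fin n)) :
    (norm2 (restrict v T)) ^ 2 = ∑ i ∈ T, (v i) ^ 2 := by
  unfold norm2
  rw [Real.sq_sqrt (Finset.sum_nonneg fun i _ => sq_nonneg _)]
  simp [_root_.restrict, ite_pow, Finset.sum_ite_mem]

lemma aux_norm2_nonneg {n : ℕ} (v : Fin n → ℝ) : 0 ≤ norm2 v := Real.sqrt_nonneg _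

lemma aux_supp {n : ℕ} {v : Fin n → ℝ} {T : Finset (Fin n)} (h : supp v ⊆ T) {i : Fin n}
    (hi : i ∉ T) : v i = 0 := by
  by_contra hc
  exact hi (h (by simp [supp, hc]))

lemma aux_supp_of {n : ℕ} {v : Fin n → ℝ} {T : Finset (Fin n)} (h : ∀ i, i ∉ T → v i = 0) :
    supp v ⊆ T := by
  intro i hi
  by_contra hc
  simp [supp, h i hc] at hi

lemma aux_adj {m N : ℕ} (Φ : Matrix (Fin m) (Fin N) ℝ) (b : Fin N → ℝ) (w : Fin m → ℝ) :
    b ⬝ᵥ (Φᵀ *ᵥ w) = (Φ *ᵥ b) ⬝ᵥ w := by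
  rw [Matrix.dotProduct_mulVec, Matrix.vecMul_transpose]

/-- the quadratic form of `I - μ Φ*Φ` on sparse vectors -/
lemma aux_diag {m N : ℕ} (Φ : Matrix (Fin m) (Fin N) ℝ) (t : ℕ) (δ μ : ℝ) (hμ : 0 ≤ μ)
    (hRIP : RIP m N Φ t δ) (v : Fin N → ℝ) (hv : (supp v).card ≤ t) :
    |v ⬝ᵥ v - μ * ((Φ *ᵥ v) ⬝ᵥ (Φ *ᵥ v))| ≤ (|μ - 1| + μ * δ) * (v ⬝ᵥ v) := by
  obtain ⟨h1, h2⟩ := hRIP v hv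
  rw [aux_norm2_sq, aux_norm2_sq] at h1 h2
  have h0 : 0 ≤ v ⬝ᵥ v := by rw [← aux_norm2_sq]; positivity
  set A := v ⬝ᵥ v
  set B := (Φ *ᵥ v) ⬝ᵥ (Φ *ᵥ v)
  have e1 := mul_le_mul_of_nonneg_left h1 hμ
  have e2 := mul_le_mul_of_nonneg_left h2 hμ
  have e3 := mul_le_mul_of_nonneg_right (le_abs_self (μ - 1)) h0
  have e4 := mul_le_mul_of_nonneg_right (neg_abs_le (μ - 1)) h0
  rw [abs_le]
  constructor <;> nlinarith

lemma aux_bilin {m N : ℕ} (Φ : Matrix (Fin m) (Fin N) ℝ) (t : ℕ) (δ μ : ℝ) (hμ : 0 ≤ μ)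
    (hRIP : RIP m N Φ t δ) (a b : Fin N → ℝ) (W : Finset (Fin N)) (hW : W.card ≤ t)
    (ha : supp a ⊆ W) (hb : supp b ⊆ W) :
    (a ⬝ᵥ b - μ * ((Φ *ᵥ a) ⬝ᵥ (Φ *ᵥ b))) ^ 2
      ≤ (|μ - 1| + μ * δ) ^ 2 * (a ⬝ᵥ a) * (b ⬝ᵥ b) := by
  set κ := |μ - 1| + μ * δ with hκ
  have key : ∀ r : ℝ, 0 ≤ (κ * (b ⬝ᵥ b)) * (r * r)
      + (2 * (a ⬝ᵥ b - μ * ((Φ *ᵥ a) ⬝ᵥ (Φ *ᵥ b)))) * r + κ * (a ⬝ᵥ a) := by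
    intro r
    have s1 : (supp (a + r • b)).card ≤ t := by
      refine (Finset.card_le_card (aux_supp_of fun i hi => ?_)).trans hW
      simp [aux_supp ha hi, aux_supp hb hi]
    have s2 : (supp (a - r • b)).card ≤ t := by
      refine (Finset.card_le_card (aux_supp_of fun i hi => ?_)).trans hW
      simp [aux_supp ha hi, aux_supp hb hi]
    have k1 := (abs_le.1 (aux_diag Φ t δ μ hμ hRIP _ s1)).1
    have k2 := (abs_le.1 (aux_diag Φ t δ μ hμ hRIP _ s2)).2
    rw [← hκ] at k1 k2
    have c1 : b ⬝ᵥ a = a ⬝ᵥ b := dotProduct_comm _ _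
    have c2 : (Φ *ᵥ b) ⬝ᵥ (Φ *ᵥ a) = (Φ *ᵥ a) ⬝ᵥ (Φ *ᵥ b) := dotProduct_comm _ _
    simp only [Matrix.mulVec_add, Matrix.mulVec_sub, Matrix.mulVec_smul, add_dotProduct,
      dotProduct_add, sub_dotProduct, dotProduct_sub, smul_dotProduct, dotProduct_smul,
      smul_eq_mul, c1, c2] at k1 k2
    linarith
  have hd := discrim_le_zero key
  unfold discrim at hd
  nlinarith

lemma aux_Q {m N : ℕ} (Φ : Matrix (Fin m) (Fin N) ℝ) (t : ℕ) (δ μ : ℝ) (hμ : 0 ≤ μ)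
    (hRIP : RIP m N Φ t δ) (v : Fin N → ℝ) (T W : Finset (Fin N)) (hW : W.card ≤ t)
    (hv : supp v ⊆ W) (hT : T ⊆ W) :
    ∑ i ∈ T, (v i - μ * (Φᵀ *ᵥ (Φ *ᵥ v)) i) ^ 2 ≤ (|μ - 1| + μ * δ) ^ 2 * ∑ i, (v i) ^ 2 := by
  set g := Φᵀ *ᵥ (Φ *ᵥ v) with hg
  set b : Fin N → ℝ := fun i => if i ∈ T then v i - μ * g i else 0 with hb
  have hbs : supp b ⊆ W := aux_supp_of fun i hi => by
    simp only [hb]; rw [if_neg (fun h => hi (hT h))]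
  have h := aux_bilin Φ t δ μ hμ hRIP b v W hW hbs hv
  rw [← aux_adj, ← hg] at h
  have e1 : b ⬝ᵥ b = ∑ i ∈ T, (v i - μ * g i) ^ 2 := by
    simp [dotProduct, hb, Finset.sum_ite_mem, sq]
  have e2 : b ⬝ᵥ v - μ * (b ⬝ᵥ g) = ∑ i ∈ T, (v i - μ * g i) ^ 2 := by
    simp only [dotProduct, hb, Finset.mul_sum, ← Finset.sum_sub_distrib]
    rw [← Finset.sum_subset (Finset.subset_univ T)]
    · exact Finset.sum_congr rfl fun i hi => by rw [if_pos hi]; ring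
    · intro i _ hi; rw [if_neg hi]; ring
  have e3 : v ⬝ᵥ v = ∑ i, (v i) ^ 2 := by simp [dotProduct, sq]
  rw [e1, e2, e3] at h
  have hX : 0 ≤ ∑ i ∈ T, (v i - μ * g i) ^ 2 := Finset.sum_nonneg fun i _ => sq_nonneg _
  have hY : 0 ≤ (|μ - 1| + μ * δ) ^ 2 * ∑ i, (v i) ^ 2 :=
    mul_nonneg (sq_nonneg _) (Finset.sum_nonneg fun i _ => sq_nonneg _)
  rcases hX.eq_or_lt with h0 | h0
  · rw [← h0]; exact hY
  · refine le_of_mul_le_mul_right ?_ h0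
    nlinarith

lemma aux_LS {m N : ℕ} (Φ : Matrix (Fin m) (Fin N) ℝ) (y : Fin m → ℝ)
    (T : Finset (Fin N)) (z : Fin N → ℝ) (h : IsLeastSquares Φ y T z) (i : Fin N) (hi : i ∈ T) :
    (Φᵀ *ᵥ (y - Φ *ᵥ z)) i = 0 := by
  set r := y - Φ *ᵥ z with hr
  set e : Fin N → ℝ := Pi.single i 1 with he
  have hei : e ⬝ᵥ (Φᵀ *ᵥ r) = (Φᵀ *ᵥ r) i := by simp [he]
  rw [aux_adj] at hei
  have key : ∀ t : ℝ, 0 ≤ ((Φ *ᵥ e) ⬝ᵥ (Φ *ᵥ e)) * (t * t) + (-2 * (Φᵀ *ᵥ r) i) * t + 0 := by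
    intro t
    have hs : supp (z + t • e) ⊆ T := aux_supp_of fun j hj => by
      have : j ≠ i := fun hh => hj (hh ▸ hi)
      simp [aux_supp h.1 hj, he, this]
    have h2 := h.2 _ hs
    have h3 : norm2 r ^ 2 ≤ norm2 (y - Φ *ᵥ (z + t • e)) ^ 2 :=
      pow_le_pow_left₀ (aux_norm2_nonneg _) h2 2
    have h4 : y - Φ *ᵥ (z + t • e) = r - t • (Φ *ᵥ e) := by
      rw [Matrix.mulVec_add, Matrix.mulVec_smul, hr]; abel
    rw [h4, aux_norm2_sq, aux_norm2_sq] at h3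
    have c1 : r ⬝ᵥ (Φ *ᵥ e) = (Φ *ᵥ e) ⬝ᵥ r := dotProduct_comm _ _
    simp only [sub_dotProduct, dotProduct_sub, smul_dotProduct, dotProduct_smul,
      smul_eq_mul, c1, hei] at h3
    linarith
  have hd := discrim_le_zero key
  unfold discrim at hd
  have : ((Φᵀ *ᵥ r) i) ^ 2 ≤ 0 := by nlinarith
  exact pow_eq_zero_iff (two_ne_zero) |>.1 (le_antisymm this (sq_nonneg _))

lemma aux_swap {n : ℕ} (h : Fin n → ℝ) (s : ℕ) (V S : Finset (Fin n)) (hV : IsLargest h s V)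
    (hS : S.card ≤ s) : ∑ i ∈ S \ V, (h i) ^ 2 ≤ ∑ i ∈ V \ S, (h i) ^ 2 := by
  have hc : (S \ V).card ≤ (V \ S).card := by
    have h1 := Finset.card_sdiff_add_card_inter S V
    have h2 := Finset.card_sdiff_add_card_inter V S
    rw [Finset.inter_comm V S] at h2
    have := hV.1
    omega
  obtain ⟨f, hf⟩ : ∃ f : (S \ V : Finset (Fin n)) → (V \ S : Finset (Fin n)),
      Function.Injective f := by
    have : Fintype.card (S \ V : Finset (Fin n)) ≤ Fintype.card (V \ S : Finset (Fin n)) := by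
      rw [Fintype.card_coe, Fintype.card_coe]; exact hc
    exact ⟨_, (Function.Embedding.nonempty_of_card_le this).some.injective⟩
  rw [← Finset.sum_coe_sort (S \ V), ← Finset.sum_coe_sort (V \ S)]
  calc ∑ i : (S \ V : Finset (Fin n)), (h i) ^ 2
      ≤ ∑ i : (S \ V : Finset (Fin n)), (h (f i)) ^ 2 := by
        refine Finset.sum_le_sum fun i _ => sq_le_sq.2 ?_
        exact hV.2 _ (Finset.mem_sdiff.1 (f i).2).1 _ (Finset.mem_sdiff.1 i.2).2
    _ = ∑ j ∈ Finset.univ.map ⟨f, hf⟩, (h j) ^ 2 := by rw [Finset.sum_map]; rfl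
    _ ≤ ∑ j : (V \ S : Finset (Fin n)), (h j) ^ 2 :=
        Finset.sum_le_sum_of_subset_of_nonneg (Finset.subset_univ _) fun _ _ _ => sq_nonneg _

/-- error of a least squares solution -/
lemma aux_LSerr {m N : ℕ} (Φ : Matrix (Fin m) (Fin N) ℝ) (t : ℕ) (δ : ℝ)
    (hRIP : RIP m N Φ t δ) (x z : Fin N → ℝ) (T W : Finset (Fin N)) (hW : W.card ≤ t)
    (hx : supp x ⊆ W) (hT : T ⊆ W) (h : IsLeastSquares Φ (Φ *ᵥ x) T z) :
    ∑ i ∈ T, (x i - z i) ^ 2 ≤ δ ^ 2 * ∑ i, (x i - z i) ^ 2 ∧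
    ∑ i, (x i - z i) ^ 2 = ∑ i ∈ T, (x i - z i) ^ 2 + ∑ i ∈ Tᶜ, (x i) ^ 2 := by
  constructor
  · have hs : supp (x - z) ⊆ W := aux_supp_of fun i hi => by
      simp [aux_supp hx hi, aux_supp h.1 (fun hh => hi (hT hh))]
    have hq := aux_Q Φ t δ 1 zero_le_one hRIP (x - z) T W hW hs hT
    simp only [sub_self, abs_zero, zero_add, one_mul, Pi.sub_apply] at hq
    refine le_trans (le_of_eq (Finset.sum_congr rfl fun i hi => ?_)) hq
    have := aux_LS Φ _ T z h i hi
    rw [← Matrix.mulVec_sub] at this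
    rw [this, sub_zero]
  · rw [← Finset.sum_add_sum_compl T]
    congr 1
    refine Finset.sum_congr rfl fun i hi => ?_
    rw [aux_supp h.1 (Finset.mem_compl.1 hi), sub_zero]

theorem stmt_19 {m N : ℕ} (Φ : Matrix (Fin m) (Fin N) ℝ) (s : ℕ) (δ μ : ℝ)
    (hδ0 : 0 ≤ δ) (hδ1 : δ < 1) (hμ : 0 ≤ μ)
    (hRIP : RIP m N Φ (3 * s) δ)
    (x : Fin N → ℝ) (hx : (supp x).card ≤ s)
    (y : Fin m → ℝ) (hy : y = Φ.mulVec x)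
    (S' : Finset (Fin N)) (hS' : S'.card ≤ s)
    (x' : Fin N → ℝ) (hx' : IsLeastSquares Φ y S' x')
    (ΔS : Finset (Fin N)) (hΔS : IsLargest (Φᵀ.mulVec (y - Φ.mulVec x')) s ΔS)
    (xt : Fin N → ℝ) (hxt : IsLeastSquares Φ y (S' ∪ ΔS) xt)
    (U : Finset (Fin N)) (hUsub : U ⊆ S' ∪ ΔS) (hU : IsLargest xt s U)
    (u : Fin N → ℝ) (hu : u = restrict xt U)
    (S'' : Finset (Fin N))
    (hS'' : IsLargest (fun i => u i + μ * (Φᵀ.mulVec (y - Φ.mulVec u)) i) s S'')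
    (ρ : ℝ)
    (hρ : ρ = 2 * δ * (|μ - 1| + μ * δ) * Real.sqrt (1 + 2 * δ ^ 2) / (1 - δ ^ 2)) :
    norm2 (restrict x S''ᶜ) ≤ ρ * norm2 (restrict x S'ᶜ) := by
  subst hy
  subst hu
  set S := supp x with hS
  have hxS : ∀ i, i ∉ S → x i = 0 := fun i hi => aux_supp (le_of_eq hS.symm) hi
  have card3 : ∀ A B C : Finset (Fin N), A.card ≤ s → B.card ≤ s → C.card ≤ s →
      (A ∪ B ∪ C).card ≤ 3 * s := by
    intro A B C hA hB hC
    have h1 := Finset.card_union_le (A ∪ B) C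
    have h2 := Finset.card_union_le A B
    omega
  -- the three error energies
  set P' := ∑ i ∈ S'ᶜ, (x i) ^ 2 with hP'
  set D' := ∑ i, (x i - x' i) ^ 2 with hD'
  set Pt := ∑ i ∈ (S' ∪ ΔS)ᶜ, (x i) ^ 2 with hPt
  set Dt := ∑ i, (x i - xt i) ^ 2 with hDt
  set Du := ∑ i, (x i - restrict xt U i) ^ 2 with hDu
  set P2 := ∑ i ∈ S''ᶜ, (x i) ^ 2 with hP2
  set κ := |μ - 1| + μ * δ with hκ
  have hκ0 : 0 ≤ κ := by positivity
  have hW1 := card3 S S' ΔS hx hS' hΔS.1.le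
  -- step 1
  have st1 : (1 - δ ^ 2) * D' ≤ P' := by
    obtain ⟨h1, h2⟩ := aux_LSerr Φ (3 * s) δ hRIP x x' S' (S ∪ S' ∪ ΔS) hW1
      (by rw [← hS]; intro i hi; simp [hi]) (by intro i hi; simp [hi]) hx'
    linarith
  -- step 2
  have st2 : Pt ≤ 2 * δ ^ 2 * D' := by
    set g := Φᵀ *ᵥ (Φ *ᵥ (x - x')) with hg
    have hgl : IsLargest g s ΔS := by rw [hg, Matrix.mulVec_sub]; exact hΔS
    have hg0 : ∀ i ∈ S', g i = 0 := fun i hi => by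
      rw [hg, Matrix.mulVec_sub]; exact aux_LS Φ _ S' x' hx' i hi
    have hsw := aux_swap g s ΔS S hgl hx
    set A := S \ (S' ∪ ΔS) with hA
    set B := ΔS \ (S ∪ S') with hB
    have hdisj : Disjoint A B := by
      rw [Finset.disjoint_left]; intro i hi hj; simp [hA, hB] at hi hj; tauto
    have hs : supp (x - x') ⊆ S ∪ S' ∪ ΔS := aux_supp_of fun i hi => by
      simp only [Finset.mem_union, not_or] at hi
      simp [hxS i hi.1.1, aux_supp hx'.1 hi.1.2]
    have hq := aux_Q Φ (3 * s) δ 1 zero_le_one hRIP (x - x') (A ∪ B) _ hW1 hs (by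
      intro i hi; simp [hA, hB] at hi ⊢; tauto)
    rw [Finset.sum_union hdisj, ← hg] at hq
    simp only [sub_self, abs_zero, zero_add, one_mul, Pi.sub_apply] at hq
    have hBg : ∑ i ∈ B, (x i - x' i - g i) ^ 2 = ∑ i ∈ ΔS \ S, (g i) ^ 2 := by
      rw [← Finset.sum_subset (s₁ := B) (s₂ := ΔS \ S)]
      · refine Finset.sum_congr rfl fun i hi => ?_
        simp [hB] at hi
        rw [hxS i hi.2.1, aux_supp hx'.1 hi.2.2]; ring
      · intro i hi; simp [hB] at hi ⊢; tauto
      · intro i hi hj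
        simp [hB] at hi hj
        rw [hg0 i (hj hi.1 hi.2)]; ring
    have hAg : ∑ i ∈ A, (g i) ^ 2 ≤ ∑ i ∈ S \ ΔS, (g i) ^ 2 :=
      Finset.sum_le_sum_of_subset_of_nonneg
        (by intro i hi; simp [hA] at hi ⊢; tauto) fun _ _ _ => sq_nonneg _
    have hPA : Pt = ∑ i ∈ A, (x i) ^ 2 := by
      symm
      refine Finset.sum_subset (by intro i hi; simp [hA] at hi ⊢; tauto) ?_
      intro i hi hj
      rw [hxS i (by simp [hA] at hi hj; tauto)]; ring
    have hfin : ∑ i ∈ A, (x i) ^ 2 ≤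
        ∑ i ∈ A, (2 * (x i - x' i - g i) ^ 2 + 2 * (g i) ^ 2) := by
      refine Finset.sum_le_sum fun i hi => ?_
      have : x' i = 0 := aux_supp hx'.1 (by simp [hA] at hi; tauto)
      rw [this]
      nlinarith [sq_nonneg (x i - 2 * g i)]
    rw [Finset.sum_add_distrib, ← Finset.mul_sum, ← Finset.mul_sum] at hfin
    linarith
  -- step 3
  obtain ⟨ht1, ht2⟩ := aux_LSerr Φ (3 * s) δ hRIP x xt (S' ∪ ΔS) (S ∪ S' ∪ ΔS) hW1
      (by rw [← hS]; intro i hi; simp [hi]) (by intro i hi; simp at hi ⊢; tauto) hxt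
  have st3 : (1 - δ ^ 2) * Dt ≤ Pt := by linarith
  -- step 4
  have st4 : Du ≤ (1 + 2 * δ ^ 2) * Dt := by
    have hsw := aux_swap xt s U S hU hx
    set T := S' ∪ ΔS with hT
    have hxt0 : ∀ i, i ∉ T → xt i = 0 := fun i hi => aux_supp hxt.1 hi
    have e1 : Du = ∑ i ∈ U, (x i - xt i) ^ 2 + ∑ i ∈ T \ U, (x i) ^ 2 + Pt := by
      rw [hDu, ← Finset.sum_add_sum_compl T, ← Finset.sum_sdiff hUsub]
      rw [add_comm (∑ i ∈ T \ U, _)]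
      congr 1
      · congr 1
        · exact Finset.sum_congr rfl fun i hi => by simp [_root_.restrict, hi]
        · exact Finset.sum_congr rfl fun i hi => by
            simp [_root_.restrict, (Finset.mem_sdiff.1 hi).2]
      · refine Finset.sum_congr rfl fun i hi => ?_
        have : i ∉ U := fun h => (Finset.mem_compl.1 hi) (hUsub h)
        simp [_root_.restrict, this]
    have e2 : ∑ i ∈ T \ U, (x i) ^ 2 = ∑ i ∈ (T \ U) ∩ S, (x i) ^ 2 := by
      symm
      refine Finset.sum_subset Finset.inter_subset_left ?_
      intro i hi hj
      rw [hxS i (fun h => hj (Finset.mem_inter.2 ⟨hi, h⟩))]; ring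
    have e3 : ∑ i ∈ (T \ U) ∩ S, (x i) ^ 2 ≤
        ∑ i ∈ (T \ U) ∩ S, (2 * (x i - xt i) ^ 2 + 2 * (xt i) ^ 2) := by
      refine Finset.sum_le_sum fun i hi => ?_
      nlinarith [sq_nonneg (x i - 2 * xt i)]
    rw [Finset.sum_add_distrib, ← Finset.mul_sum, ← Finset.mul_sum] at e3
    have e4 : ∑ i ∈ (T \ U) ∩ S, (xt i) ^ 2 ≤ ∑ i ∈ S \ U, (xt i) ^ 2 :=
      Finset.sum_le_sum_of_subset_of_nonneg
        (by intro i hi; simp only [Finset.mem_inter, Finset.mem_sdiff] at hi ⊢; tauto)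
        fun _ _ _ => sq_nonneg _
    have e5 : ∑ i ∈ U \ S, (xt i) ^ 2 ≤ ∑ i ∈ U, (x i - xt i) ^ 2 := by
      calc ∑ i ∈ U \ S, (xt i) ^ 2 = ∑ i ∈ U \ S, (x i - xt i) ^ 2 :=
            Finset.sum_congr rfl fun i hi => by
              rw [hxS i (Finset.mem_sdiff.1 hi).2]; ring
        _ ≤ _ := Finset.sum_le_sum_of_subset_of_nonneg Finset.sdiff_subset
            fun _ _ _ => sq_nonneg _
    have e6 : ∑ i ∈ (T \ U) ∩ S, (x i - xt i) ^ 2 ≤ ∑ i ∈ T \ U, (x i - xt i) ^ 2 :=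
      Finset.sum_le_sum_of_subset_of_nonneg Finset.inter_subset_left fun _ _ _ => sq_nonneg _
    have e7 := Finset.sum_sdiff (f := fun i => (x i - xt i) ^ 2) hUsub
    have e8 : 0 ≤ ∑ i ∈ T \ U, (x i - xt i) ^ 2 := Finset.sum_nonneg fun _ _ => sq_nonneg _
    linarith
  -- step 5
  have st5 : P2 ≤ 2 * κ ^ 2 * Du := by
    set u := restrict xt U with hu
    have hu0 : ∀ i, i ∉ U → u i = 0 := fun i hi => by simp [hu, _root_.restrict, hi]
    set g := Φᵀ *ᵥ (Φ *ᵥ (x - u)) with hg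
    rw [← Matrix.mulVec_sub, ← hg] at hS''
    have hsw := aux_swap _ s S'' S hS'' hx
    have hs : supp (x - u) ⊆ S ∪ U ∪ S'' := aux_supp_of fun i hi => by
      simp only [Finset.mem_union, not_or] at hi
      simp [hxS i hi.1.1, hu0 i hi.1.2]
    have hdisj : Disjoint (S \ S'') (S'' \ S) := by
      rw [Finset.disjoint_left]; intro i hi hj; simp at hi hj; tauto
    have hq := aux_Q Φ (3 * s) δ μ hμ hRIP (x - u) ((S \ S'') ∪ (S'' \ S)) _
      (card3 S U S'' hx hU.1.le hS''.1.le) hs (by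
        intro i hi; simp at hi ⊢; tauto)
    rw [Finset.sum_union hdisj, ← hg] at hq
    simp only [Pi.sub_apply] at hq
    have hB : ∑ i ∈ S'' \ S, (x i - u i - μ * g i) ^ 2 =
        ∑ i ∈ S'' \ S, (u i + μ * g i) ^ 2 :=
      Finset.sum_congr rfl fun i hi => by
        rw [hxS i (Finset.mem_sdiff.1 hi).2]; ring
    have hPA : P2 = ∑ i ∈ S \ S'', (x i) ^ 2 := by
      symm
      refine Finset.sum_subset (by intro i hi; simp at hi ⊢; tauto) ?_
      intro i hi hj
      rw [hxS i (by simp at hi hj; tauto)]; ring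
    have hfin : ∑ i ∈ S \ S'', (x i) ^ 2 ≤
        ∑ i ∈ S \ S'', (2 * (x i - u i - μ * g i) ^ 2 + 2 * (u i + μ * g i) ^ 2) := by
      refine Finset.sum_le_sum fun i hi => ?_
      nlinarith [sq_nonneg (x i - 2 * (u i + μ * g i))]
    rw [Finset.sum_add_distrib, ← Finset.mul_sum, ← Finset.mul_sum] at hfin
    linarith
  -- conclusion
  have hd : 0 < 1 - δ ^ 2 := by nlinarith
  have hρ0 : 0 ≤ ρ := by rw [hρ]; positivity
  have hρ2 : ρ ^ 2 = 4 * δ ^ 2 * κ ^ 2 * (1 + 2 * δ ^ 2) / (1 - δ ^ 2) ^ 2 := by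
    rw [hρ, div_pow, mul_pow, Real.sq_sqrt (by positivity)]; ring
  refine (sq_le_sq₀ (aux_norm2_nonneg _) (mul_nonneg hρ0 (aux_norm2_nonneg _))).1 ?_
  rw [mul_pow, aux_restrict_sq, aux_restrict_sq, ← hP', ← hP2, hρ2]
  rw [div_mul_eq_mul_div, le_div_iff₀ (by positivity)]
  calc P2 * (1 - δ ^ 2) ^ 2 ≤ (2 * κ ^ 2 * ((1 + 2 * δ ^ 2) * Dt)) * (1 - δ ^ 2) ^ 2 := by
        gcongr; exact st5.trans (by gcongr)
    _ = 2 * κ ^ 2 * (1 + 2 * δ ^ 2) * (1 - δ ^ 2) * ((1 - δ ^ 2) * Dt) := by ring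
    _ ≤ 2 * κ ^ 2 * (1 + 2 * δ ^ 2) * (1 - δ ^ 2) * (2 * δ ^ 2 * D') := by
        exact mul_le_mul_of_nonneg_left (st3.trans st2) (by positivity)
    _ = 4 * δ ^ 2 * κ ^ 2 * (1 + 2 * δ ^ 2) * ((1 - δ ^ 2) * D') := by ring
    _ ≤ 4 * δ ^ 2 * κ ^ 2 * (1 + 2 * δ ^ 2) * P' := by gcongr
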